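/- arXiv:2603.21694 — 6 statements merged into one kernel-verified Lean document; each statement's English description precedes it below -/
import Mathlib

section
/- Let Y₁ and Y₂ be probability mass functions on types β₁ and β₂ with finite support, and let φ₁ : β₁ → α and φ₂ : β₂ → α be morphisms of distributions to a common probability mass function X on α, i.e. X = Y₁.map φ₁ and X = Y₂.map φ₂. Then the fiber-product mass function p : β₁ × β₂ → ℝ≥0∞ defined by p(y₁,y₂) = Y₁(y₁)·Y₂(y₂)/X(φ₁ y₁) if φ₁ y₁ = φ₂ y₂ and p(y₁,y₂) = 0 otherwise (with the extended nonnegative reals convention 0/0 = 0) has total mass one: ∑' (y₁,y₂), p(y₁,y₂) = 1. In particular p defines a probability mass function, the fiber product Y₁ ×_X Y₂. -/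
open scoped ENNReal

/-- The fiber-product mass function of two morphisms of finite distributions
`φ₁ : Y₁ → X` and `φ₂ : Y₂ → X` has total mass one. -/
theorem stmt_0 {α β₁ β₂ : Type*} [DecidableEq α]
    (Y₁ : PMF β₁) (Y₂ : PMF β₂)
    (hY₁ : Y₁.support.Finite) (hY₂ : Y₂.support.Finite)
    (φ₁ : β₁ → α) (φ₂ : β₂ → α) (X : PMF α)
    (hX₁ : X = Y₁.map φ₁) (hX₂ : X = Y₂.map φ₂)
    (p : β₁ × β₂ → ℝ≥0∞)
    (hp : ∀ yz : β₁ × β₂,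
      p yz = if φ₁ yz.1 = φ₂ yz.2 then Y₁ yz.1 * Y₂ yz.2 / X (φ₁ yz.1) else 0) :
    ∑' yz : β₁ × β₂, p yz = 1 := by
  have fiber_mass (y : β₁) : ∑' z, (if φ₁ y = φ₂ z then Y₂ z else 0) = X (φ₁ y) := by
    rw [hX₂, PMF.map_apply]
    exact tsum_congr fun z => by split_ifs <;> rfl
  have marginal (y : β₁) : ∑' z, p (y, z) = Y₁ y := by
    have hfac (z : β₂) :
        p (y, z) = Y₁ y * (X (φ₁ y))⁻¹ * (if φ₁ y = φ₂ z then Y₂ z else 0) := by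
      rw [hp]
      split_ifs
      · rw [div_eq_mul_inv, mul_right_comm]
      · rw [mul_zero]
    rw [tsum_congr hfac, ENNReal.tsum_mul_left, fiber_mass, mul_assoc]
    by_cases hy : Y₁ y = 0
    · rw [hy, zero_mul]
    · have hX : X (φ₁ y) ≠ 0 := by
        rw [← PMF.mem_support_iff, hX₁, PMF.support_map]
        exact ⟨y, (PMF.mem_support_iff _ _).2 hy, rfl⟩
      rw [ENNReal.inv_mul_cancel hX (X.apply_ne_top _), mul_one]
  rw [ENNReal.tsum_prod', tsum_congr marginal, Y₁.tsum_coe]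
end

section
/- Let Y₁ and Y₂ be probability mass functions on types β₁ and β₂ with finite support, and let φ₁ : β₁ → α and φ₂ : β₂ → α be morphisms of distributions to a common probability mass function X on α, i.e. X = Y₁.map φ₁ and X = Y₂.map φ₂, and let p be the fiber-product mass function. Then for every y₁ : β₁ one has ∑' y₂, p(y₁,y₂) = Y₁(y₁); that is, the first projection pr₁ is a morphism of distributions from the fiber product Y₁ ×_X Y₂ to Y₁ (and symmetrically for the second projection). -/
open scoped ENNReal

/-- The first projection is a morphism of distributions from the fiber product
`Y₁ ×_X Y₂` to `Y₁`: summing the fiber-product mass function over the second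
coordinate recovers `Y₁`. -/
theorem stmt_1 {α β₁ β₂ : Type*} [DecidableEq α]
    (Y₁ : PMF β₁) (Y₂ : PMF β₂)
    (hY₁ : Y₁.support.Finite) (hY₂ : Y₂.support.Finite)
    (φ₁ : β₁ → α) (φ₂ : β₂ → α) (X : PMF α)
    (hX₁ : X = Y₁.map φ₁) (hX₂ : X = Y₂.map φ₂)
    (p : β₁ × β₂ → ℝ≥0∞)
    (hp : ∀ yz : β₁ × β₂,
      p yz = if φ₁ yz.1 = φ₂ yz.2 then Y₁ yz.1 * Y₂ yz.2 / X (φ₁ yz.1) else 0) :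
    ∀ y₁ : β₁, ∑' y₂ : β₂, p (y₁, y₂) = Y₁ y₁ := by
  classical
  intro y₁
  have hfib : ∑' y₂ : β₂, (if φ₁ y₁ = φ₂ y₂ then Y₂ y₂ else 0) = X (φ₁ y₁) := by
    rw [hX₂, PMF.map_apply]
    refine tsum_congr fun y₂ => ?_
    congr
  have hle : Y₁ y₁ ≤ X (φ₁ y₁) := by
    rw [hX₁, PMF.map_apply]
    refine le_trans ?_ (ENNReal.le_tsum y₁)
    simp
  have hsum : ∑' y₂ : β₂, p (y₁, y₂) = Y₁ y₁ / X (φ₁ y₁) * X (φ₁ y₁) := by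
    rw [← hfib, ← ENNReal.tsum_mul_left, hfib]
    refine tsum_congr fun y₂ => ?_
    rw [hp]
    split_ifs
    · simp only [div_eq_mul_inv, mul_right_comm]
    · simp
  rw [hsum]
  exact ENNReal.div_mul_cancel' (fun h => le_antisymm (h ▸ hle) zero_le)
    (fun h => absurd h (X.apply_ne_top _))
end

section
/- Let p and q be distinct odd primes and N = p·q. Let η be a unit of ZMod N whose image under the reduction ring homomorphism ZMod N → ZMod p is not a square and whose image in ZMod q is not a square, let u and ξ be units of ZMod N, and let m be a natural number with m ≤ 1. Then the image in ZMod p of the Goldwasser–Micali ciphertext η^m · u^(2m) · ξ^2 is a square if and only if m = 0. (Correctness of Goldwasser–Micali decryption: Dec(Enc(m)) = m.) -/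
/-- Multiplying by the square of a unit does not change whether an element is a square. -/
theorem isSquare_mul_units_sq_iff {M : Type*} [CommMonoid M] (a : M) (v : Mˣ) :
    IsSquare (a * (v : M) ^ 2) ↔ IsSquare a := by
  refine ⟨fun h => ?_, fun h => h.mul (IsSquare.sq _)⟩
  have key : a * (v : M) ^ 2 * ((v⁻¹ : Mˣ) : M) ^ 2 = a := by
    rw [mul_assoc, ← mul_pow, Units.mul_inv, one_pow, mul_one]
  exact key ▸ h.mul (IsSquare.sq _)


/-- Correctness of Goldwasser–Micali decryption: the ciphertext
`η^m · u^(2m) · ξ²` is a quadratic residue modulo `p` iff `m = 0`. -/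
theorem stmt_5 (p q : ℕ) (hp : p.Prime) (hq : q.Prime)
    (hp2 : p ≠ 2) (hq2 : q ≠ 2) (hpq : p ≠ q)
    (η u ξ : (ZMod (p * q))ˣ)
    (hηp : ¬ IsSquare ((ZMod.castHom (dvd_mul_right p q) (ZMod p)) (η : ZMod (p * q))))
    (hηq : ¬ IsSquare ((ZMod.castHom (dvd_mul_left q p) (ZMod q)) (η : ZMod (p * q))))
    (m : ℕ) (hm : m ≤ 1) :
    IsSquare ((ZMod.castHom (dvd_mul_right p q) (ZMod p))
        ((η ^ m * u ^ (2 * m) * ξ ^ 2 : (ZMod (p * q))ˣ) : ZMod (p * q))) ↔ m = 0 := by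
  set f := ZMod.castHom (dvd_mul_right p q) (ZMod p)
  have cipher : f ((η ^ m * u ^ (2 * m) * ξ ^ 2 : (ZMod (p * q))ˣ) : ZMod (p * q)) =
      f η ^ m * ((Units.map (f : ZMod (p * q) →* ZMod p) (u ^ m * ξ) : (ZMod p)ˣ) : ZMod p) ^ 2 := by
    simp only [Units.coe_map, Units.val_mul, Units.val_pow_eq_pow_val, MonoidHom.coe_coe,
      map_mul, map_pow]
    ring
  rw [cipher, isSquare_mul_units_sq_iff]
  interval_cases m
  · simp
  · simpa using hηp
end

section
/- Let p be a prime, n a natural number, S a finite subset of Fin n, x : Fin n → ℕ with x(i) ≥ 1 for every i ∈ S and 1 + ∑_{i ∈ S} x(i) = p, and let c : Fin n → ℕ satisfy c(i) ≤ 1 for all i. Then in ZMod p one has 1 − (1 + ∑_{i ∈ S} (c(i)·x(i) : ZMod p))^(p−1) = ((∏_{i ∈ S} c(i) : ℕ) : ZMod p). (Correctness of the decryption representation Dec(sk, c) = 1 − (1 + ⟨c, sk⟩)^(p−1) used in the third bridge.) -/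
/-- Correctness of the decryption representation
`Dec(sk, c) = 1 - (1 + ⟨c, sk⟩)^(p-1)` used in the third bridge from CSGN. -/
theorem stmt_8 (p n : ℕ) (hp : p.Prime) (S : Finset (Fin n)) (x : Fin n → ℕ)
    (hx : ∀ i ∈ S, 1 ≤ x i) (hsum : 1 + ∑ i ∈ S, x i = p)
    (c : Fin n → ℕ) (hc : ∀ i, c i ≤ 1) :
    (1 : ZMod p) - (1 + ∑ i ∈ S, ((c i * x i : ℕ) : ZMod p)) ^ (p - 1)
      = ((∏ i ∈ S, c i : ℕ) : ZMod p) := by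
  have : Fact p.Prime := ⟨hp⟩
  by_cases hS : ∀ i ∈ S, c i = 1
  · have hzero : (1 : ZMod p) + ∑ i ∈ S, ((c i * x i : ℕ) : ZMod p) = 0 := by
      rw [Finset.sum_congr rfl fun i hi ↦ by rw [hS i hi, one_mul]]
      have h := congrArg (Nat.cast : ℕ → ZMod p) hsum
      push_cast at h
      rw [h, ZMod.natCast_self]
    rw [hzero, zero_pow (Nat.sub_ne_zero_of_lt hp.one_lt), Finset.prod_eq_one hS]
    simp
  · push Not at hS
    obtain ⟨j, hj, hcj⟩ := hS
    have hcj0 : c j = 0 := by have := hc j; omega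
    have hlt : ∑ i ∈ S, c i * x i < ∑ i ∈ S, x i := by
      refine Finset.sum_lt_sum (fun i _ ↦ mul_le_of_le_one_left (Nat.zero_le _) (hc i)) ⟨j, hj, ?_⟩
      rw [hcj0, zero_mul]
      exact hx j hj
    have hne : (1 : ZMod p) + ∑ i ∈ S, ((c i * x i : ℕ) : ZMod p) ≠ 0 := by
      intro h
      have hdvd : p ∣ 1 + ∑ i ∈ S, c i * x i := by
        rw [← ZMod.natCast_eq_zero_iff]
        exact_mod_cast h
      have := Nat.le_of_dvd (by omega) hdvd
      omega
    rw [ZMod.pow_card_sub_one_eq_one hne, Finset.prod_eq_zero hj hcj0]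
    simp
end

section
/- Let n ≥ 1 and let v, w : Fin n → ZMod 2 be nonzero vectors. Let G denote the group of invertible n×n matrices over ZMod 2. Then (2^n − 1) multiplied by the number of pairs (A, B) ∈ G × G with A·v + B·w = 0 equals (card G)². (Equivalently, for A and B independent and uniform on G, the probability that A·v + B·w = 0, i.e. that the SYY product decrypts incorrectly, is exactly 1/(2^n − 1), which is exponentially small in n.) -/
open Matrix

namespace Matrix

variable {K ι : Type*} [Field K] [Fintype ι] [DecidableEq ι]

theorem exists_units_mulVec_eq {v w : ι → K} (hv : v ≠ 0) (hw : w ≠ 0) :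
    ∃ g : (Matrix ι ι K)ˣ, (g : Matrix ι ι K) *ᵥ v = w := by
  obtain ⟨e, he⟩ := Submodule.exists_linearEquiv_restrict_eq
    ((LinearEquiv.toSpanNonzeroSingleton K _ v hv).symm ≪≫ₗ
      LinearEquiv.toSpanNonzeroSingleton K _ w hw)
  have hev : e v = w := by
    have h := he (LinearEquiv.toSpanNonzeroSingleton K _ v hv 1)
    rw [LinearEquiv.trans_apply, LinearEquiv.symm_apply_apply] at h
    simpa using h.symm
  refine ⟨⟨LinearMap.toMatrix' e.toLinearMap, LinearMap.toMatrix' e.symm.toLinearMap, ?_, ?_⟩, ?_⟩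
  · simp [← LinearMap.toMatrix'_comp]
  · simp [← LinearMap.toMatrix'_comp]
  · simpa [LinearMap.toMatrix'_mulVec] using hev

theorem units_mulVec_ne_zero (g : (Matrix ι ι K)ˣ) {v : ι → K} (hv : v ≠ 0) :
    (g : Matrix ι ι K) *ᵥ v ≠ 0 :=
  fun h ↦ hv (mulVec_injective_of_isUnit g.isUnit (h.trans (mulVec_zero _).symm))

/-- The invertible matrices sending one nonzero vector to another, paired with the nonzero
vectors, are in bijection with all invertible matrices. -/
theorem card_ne_zero_mul_card_units_mulVec_eq {v w : ι → K} (hv : v ≠ 0) (hw : w ≠ 0) :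
    Nat.card {u : ι → K // u ≠ 0} *
        Nat.card {g : (Matrix ι ι K)ˣ // (g : Matrix ι ι K) *ᵥ v = w} =
      Nat.card (Matrix ι ι K)ˣ := by
  choose g hg using fun u : {u : ι → K // u ≠ 0} ↦ exists_units_mulVec_eq hw u.2
  have hg' (u : {u : ι → K // u ≠ 0}) : (↑(g u)⁻¹ : Matrix ι ι K) *ᵥ u = w := by
    conv_lhs => rw [← hg u]
    simp
  rw [← Nat.card_prod]
  exact Nat.card_congr
    { toFun x := g x.1 * x.2
      invFun h := ⟨⟨(h : Matrix ι ι K) *ᵥ v, units_mulVec_ne_zero h hv⟩,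
        ⟨(g ⟨(h : Matrix ι ι K) *ᵥ v, units_mulVec_ne_zero h hv⟩)⁻¹ * h, by
          rw [Units.val_mul, ← mulVec_mulVec, hg' ⟨_, units_mulVec_ne_zero h hv⟩]⟩⟩
      left_inv := by
        rintro ⟨u, h, hh⟩
        have hu : ((g u * h : (Matrix ι ι K)ˣ) : Matrix ι ι K) *ᵥ v = u := by
          rw [Units.val_mul, ← mulVec_mulVec, hh, hg]
        simp only [hu, inv_mul_cancel_left, Subtype.coe_eta]
      right_inv h := mul_inv_cancel_left _ _ }

theorem card_units_mulVec_add_mulVec_eq_zero (v w : ι → K) :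
    Nat.card {x : (Matrix ι ι K)ˣ × (Matrix ι ι K)ˣ //
        (x.1 : Matrix ι ι K) *ᵥ v + (x.2 : Matrix ι ι K) *ᵥ w = 0} =
      Nat.card (Matrix ι ι K)ˣ *
        Nat.card {g : (Matrix ι ι K)ˣ // (g : Matrix ι ι K) *ᵥ v = -w} := by
  have key (a b : (Matrix ι ι K)ˣ) : (a : Matrix ι ι K) *ᵥ v + (b : Matrix ι ι K) *ᵥ w = 0 ↔
      ((b⁻¹ * a : (Matrix ι ι K)ˣ) : Matrix ι ι K) *ᵥ v = -w := by
    rw [add_eq_zero_iff_eq_neg, ← mulVec_neg, Units.val_mul, ← mulVec_mulVec]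
    constructor <;> intro h
    · simp [h]
    · simp [← h]
  rw [← Nat.card_prod]
  exact Nat.card_congr
    { toFun x := ⟨x.1.2, x.1.2⁻¹ * x.1.1, (key _ _).1 x.2⟩
      invFun x := ⟨⟨x.1 * x.2, x.1⟩, (key _ _).2 (by rw [inv_mul_cancel_left]; exact x.2.2)⟩
      left_inv x := by simp
      right_inv x := by simp }

end Matrix


/-- For independent uniform `A, B` in `GLₙ(𝔽₂)` and nonzero `v, w`, the
probability that `A·v + B·w = 0` (i.e. that the SYY product decrypts
incorrectly) is exactly `1 / (2ⁿ - 1)`. -/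
theorem stmt_16 (n : ℕ) (hn : 1 ≤ n) (v w : Fin n → ZMod 2)
    (hv : v ≠ 0) (hw : w ≠ 0) :
    (2 ^ n - 1) *
        Nat.card {AB : (Matrix (Fin n) (Fin n) (ZMod 2))ˣ × (Matrix (Fin n) (Fin n) (ZMod 2))ˣ //
          (AB.1 : Matrix (Fin n) (Fin n) (ZMod 2)).mulVec v
            + (AB.2 : Matrix (Fin n) (Fin n) (ZMod 2)).mulVec w = 0}
      = (Nat.card (Matrix (Fin n) (Fin n) (ZMod 2))ˣ) ^ 2 := by
  have hcard : Nat.card {u : Fin n → ZMod 2 // u ≠ 0} = 2 ^ n - 1 := by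
    rw [Nat.card_eq_fintype_card, Fintype.card_subtype_compl, Fintype.card_subtype_eq]
    simp
  have h := Matrix.card_ne_zero_mul_card_units_mulVec_eq hv (neg_ne_zero.2 hw)
  rw [hcard] at h
  rw [Matrix.card_units_mulVec_add_mulVec_eq_zero, mul_left_comm, h, sq]
end

section
/- Let p be an odd prime, ℓ ≥ 1, let d be a nonzero element of ZMod p, let A be an invertible ℓ×ℓ matrix over ZMod 2, for each i let w_i ∈ ℕ be the number of indices j with A(i,j) = 1, and let r : Fin ℓ → (ZMod p)ˣ be any family of units. Then d^{w_i}·(r_i)² is a square in ZMod p for every i if and only if d is a square in ZMod p. (Correctness of the bridge from the Goldwasser–Micali scheme to the Sander–Young–Yung scheme: the output vector (t₁r₁², …, t_ℓ r_ℓ²) with t_i = d^{w_i} decrypts under SYY to Dec_GM of the input.) -/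
theorem isSquare_mul_sq_iff {F : Type*} [Field F] {a b : F} (ha : a ≠ 0) :
    IsSquare (b * a ^ 2) ↔ IsSquare b := by
  refine ⟨fun h => ?_, fun h => h.mul (IsSquare.sq a)⟩
  simpa [ha] using h.div (IsSquare.sq a)

theorem isSquare_pow_iff_of_odd {F : Type*} [Field F] {d : F} (hd : d ≠ 0) {n : ℕ}
    (hn : Odd n) : IsSquare (d ^ n) ↔ IsSquare d := by
  obtain ⟨k, rfl⟩ := hn
  rw [show d ^ (2 * k + 1) = d * (d ^ k) ^ 2 by ring]
  exact isSquare_mul_sq_iff (pow_ne_zero k hd)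

theorem ZMod.natCast_card_filter_eq_one {ι : Type*} [Fintype ι] (v : ι → ZMod 2) :
    ((Finset.univ.filter fun j => v j = 1).card : ZMod 2) = ∑ j, v j := by
  rw [Finset.natCast_card_filter]
  refine Finset.sum_congr rfl fun j _ => ?_
  generalize v j = x
  revert x
  decide

/-- Otherwise the all-ones vector would lie in the kernel of `A`. -/
theorem Matrix.exists_odd_card_row_of_isUnit {n : Type*} [Fintype n] [DecidableEq n] [Nonempty n]
    {A : Matrix n n (ZMod 2)} (hA : IsUnit A) :
    ∃ i, Odd (Finset.univ.filter fun j => A i j = 1).card := by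
  by_contra! h
  have hker : A.mulVec 1 = A.mulVec 0 := by
    ext i
    have hi := ZMod.natCast_eq_zero_iff_even.mpr (Nat.not_odd_iff_even.mp (h i))
    rw [ZMod.natCast_card_filter_eq_one] at hi
    simpa [Matrix.mulVec, dotProduct] using hi
  exact one_ne_zero (Matrix.mulVec_injective_of_isUnit hA hker)

/-- Correctness of the bridge from Goldwasser–Micali to Sander–Young–Yung:
with `w i` the number of ones in row `i` of an invertible matrix `A` over `𝔽₂`,
every component `d^(w i)·(r i)²` is a square modulo `p` iff `d` is. -/
theorem stmt_19 (p : ℕ) (hp : p.Prime) (hp2 : p ≠ 2) (ℓ : ℕ) (hℓ : 1 ≤ ℓ)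
    (d : ZMod p) (hd : d ≠ 0)
    (A : Matrix (Fin ℓ) (Fin ℓ) (ZMod 2)) (hA : IsUnit A)
    (w : Fin ℓ → ℕ)
    (hw : ∀ i, w i = (Finset.univ.filter fun j => A i j = 1).card)
    (r : Fin ℓ → (ZMod p)ˣ) :
    (∀ i, IsSquare (d ^ w i * ((r i : ZMod p)) ^ 2)) ↔ IsSquare d := by
  have : Fact p.Prime := ⟨hp⟩
  have : Nonempty (Fin ℓ) := ⟨⟨0, hℓ⟩⟩
  refine ⟨fun h => ?_, fun h i => (h.pow (w i)).mul (IsSquare.sq _)⟩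
  obtain ⟨i, hi⟩ := Matrix.exists_odd_card_row_of_isUnit hA
  rw [← hw i] at hi
  exact (isSquare_pow_iff_of_odd hd hi).mp ((isSquare_mul_sq_iff (r i).ne_zero).mp (h i))
end
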